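/- arXiv:1411.5063 — 5 statements merged into one kernel-verified Lean document; each statement's English description precedes it below -/
import Mathlib

section
/- Let d ≥ 4 and let f₃ = x₀^{d-2}x₁² + x₀^{d-1}x₂ ∈ ℂ[x₀,x₁,x₂]. A homogeneous polynomial g of degree 2 in ℂ[y₀,y₁,y₂] annihilates f₃ (i.e. g(∂₀,∂₁,∂₂)f₃ = 0) if and only if g lies in the ℂ-linear span of the three quadrics 2y₀y₂ − (d−1)y₁², y₁y₂, y₂². -/
open MvPolynomial

/-- The differential action of `g ∈ ℂ[y₀,…,y_{n-1}]` on `f ∈ ℂ[x₀,…,x_{n-1}]`: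
`g(∂₀,…,∂_{n-1}) f`, obtained by substituting the partial derivative `∂/∂xᵢ` for `yᵢ`. -/
noncomputable def diffOp {n : ℕ} (g f : MvPolynomial (Fin n) ℂ) : MvPolynomial (Fin n) ℂ :=
  g.support.sum fun m =>
    g.coeff m •
      ((List.ofFn fun i : Fin n =>
        ((MvPolynomial.pderiv i).toLinearMap ^ (m i) :
          Module.End ℂ (MvPolynomial (Fin n) ℂ))).prod f)

theorem diffOp_eq_sum {n : ℕ} {g : MvPolynomial (Fin n) ℂ} (f : MvPolynomial (Fin n) ℂ)
    {s : Finset (Fin n →₀ ℕ)} (hs : g.support ⊆ s) :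
    diffOp g f = s.sum fun m =>
      g.coeff m •
        ((List.ofFn fun i : Fin n =>
          ((pderiv i).toLinearMap ^ (m i) : Module.End ℂ (MvPolynomial (Fin n) ℂ))).prod f) := by
  refine Finset.sum_subset hs fun m _ hm => ?_
  rw [notMem_support_iff.mp hm, zero_smul]

theorem diffOp_add {n : ℕ} (g h f : MvPolynomial (Fin n) ℂ) :
    diffOp (g + h) f = diffOp g f + diffOp h f := by
  classical
  rw [diffOp_eq_sum f (support_add (p := g) (q := h)),
    diffOp_eq_sum f (Finset.subset_union_left (s₁ := g.support) (s₂ := h.support)),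
    diffOp_eq_sum f (Finset.subset_union_right (s₁ := g.support) (s₂ := h.support)),
    ← Finset.sum_add_distrib]
  simp only [coeff_add, add_smul]

theorem diffOp_monomial {n : ℕ} (m : Fin n →₀ ℕ) (a : ℂ) (f : MvPolynomial (Fin n) ℂ) :
    diffOp (monomial m a) f = a •
      ((List.ofFn fun i : Fin n =>
        ((pderiv i).toLinearMap ^ (m i) : Module.End ℂ (MvPolynomial (Fin n) ℂ))).prod f) := by
  rw [diffOp_eq_sum f support_monomial_subset, Finset.sum_singleton, coeff_monomial, if_pos rfl]

theorem diffOp_C_mul_X_mul_X (a : ℂ) {i j : Fin 3} (hij : i ≤ j)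
    (f : MvPolynomial (Fin 3) ℂ) :
    diffOp (C a * (X i * X j)) f = C a * pderiv i (pderiv j f) := by
  have hm : (C a * (X i * X j) : MvPolynomial (Fin 3) ℂ)
      = monomial (Finsupp.single i 1 + Finsupp.single j 1) a := by
    simp [X, C_mul_monomial, monomial_mul]
  rw [hm, diffOp_monomial, smul_eq_C_mul]
  fin_cases i <;> fin_cases j <;> simp at hij <;>
    simp [List.ofFn_succ, Finsupp.single_apply, pow_two]

theorem pderiv_ofNat {σ R : Type*} [CommSemiring R] (i : σ) (k : ℕ) [k.AtLeastTwo] :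
    pderiv i (ofNat(k) : MvPolynomial σ R) = 0 :=
  (pderiv i).map_natCast k

/-- A ternary quadratic form is a combination of the six quadratic monomials. -/
theorem exists_eq_of_isHomogeneous_two {R : Type*} [CommRing R] {g : MvPolynomial (Fin 3) R}
    (hg : g.IsHomogeneous 2) :
    ∃ a b c p q r : R, g = C a * (X 0 * X 0) + C b * (X 0 * X 1) + C c * (X 0 * X 2) +
      C p * (X 1 * X 1) + C q * (X 1 * X 2) + C r * (X 2 * X 2) := by
  let e (i j : Fin 3) : Fin 3 →₀ ℕ := Finsupp.single i 1 + Finsupp.single j 1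
  have he (i j : Fin 3) (a : R) : C a * (X i * X j) = monomial (e i j) a := by
    simp [e, X, C_mul_monomial, monomial_mul]
  refine ⟨g.coeff (e 0 0), g.coeff (e 0 1), g.coeff (e 0 2), g.coeff (e 1 1), g.coeff (e 1 2),
    g.coeff (e 2 2), ?_⟩
  have hexp (m : Fin 3 →₀ ℕ) (hm : m.degree = 2) :
      m = e 0 0 ∨ m = e 0 1 ∨ m = e 0 2 ∨ m = e 1 1 ∨ m = e 1 2 ∨ m = e 2 2 := by
    simp only [Finsupp.degree_eq_sum, Fin.sum_univ_three] at hm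
    simp only [e, Finsupp.ext_iff, Fin.forall_fin_succ, Finsupp.add_apply, Finsupp.single_apply]
    simp
    omega
  have hinj (i j k l : Fin 3) : e i j = e k l ↔ (i = k ∧ j = l) ∨ (i = l ∧ j = k) := by
    simp only [e, Finsupp.ext_iff, Finsupp.add_apply, Finsupp.single_apply]
    revert i j k l
    decide
  ext m
  simp only [he, coeff_add, coeff_monomial]
  by_cases hm : m.degree = 2
  · rcases hexp m hm with rfl | rfl | rfl | rfl | rfl | rfl <;> simp [hinj]
  · have hne (i j : Fin 3) : e i j ≠ m := by
      rintro rfl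
      simp [e] at hm
    simp [hne, hg.coeff_eq_zero hm]

theorem stmt_2 (d : ℕ) (hd : 4 ≤ d)
    (f₃ : MvPolynomial (Fin 3) ℂ) (hf₃ : f₃ = X 0 ^ (d - 2) * X 1 ^ 2 + X 0 ^ (d - 1) * X 2)
    (g : MvPolynomial (Fin 3) ℂ) (hg : g.IsHomogeneous 2) :
    diffOp g f₃ = 0 ↔
      g ∈ Submodule.span ℂ
        ({2 * (X 0 * X 2) - C ((d : ℂ) - 1) * X 1 ^ 2, X 1 * X 2, X 2 ^ 2} :
          Set (MvPolynomial (Fin 3) ℂ)) := by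
  obtain ⟨n, rfl⟩ := Nat.exists_eq_add_of_le' hd
  have hC (k : ℕ) [k.AtLeastTwo] : (C ofNat(k) : MvPolynomial (Fin 3) ℂ) = ofNat(k) :=
    map_ofNat C k
  have hdiff (a b c p q r : ℂ) :
      diffOp (C a * (X 0 * X 0) + C b * (X 0 * X 1) + C c * (X 0 * X 2) +
        C p * (X 1 * X 1) + C q * (X 1 * X 2) + C r * (X 2 * X 2)) f₃ =
      (C a * (C ((n + 2) * (n + 1) : ℂ) * X 0 ^ n * X 1 ^ 2 +
          C ((n + 3) * (n + 2) : ℂ) * X 0 ^ (n + 1) * X 2) +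
        C b * (C (2 * (n + 2) : ℂ) * X 0 ^ (n + 1) * X 1) +
        C (c * (n + 3) + 2 * p) * X 0 ^ (n + 2) : MvPolynomial (Fin 3) ℂ) := by
    simp only [diffOp_add, diffOp_C_mul_X_mul_X, Fin.zero_le, le_refl,
      show (1 : Fin 3) ≤ 2 by decide, hf₃, show n + 4 - 2 = n + 2 by omega,
      show n + 4 - 1 = n + 3 by omega]
    simp [hC, pderiv_ofNat]
    ring
  have hn2 : (n : ℂ) + 2 ≠ 0 := by exact_mod_cast Nat.succ_ne_zero (n + 1)
  have hn3 : (n : ℂ) + 3 ≠ 0 := by exact_mod_cast Nat.succ_ne_zero (n + 2)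
  rw [Submodule.mem_span_triple]
  constructor
  · obtain ⟨a, b, c, p, q, r, rfl⟩ := exists_eq_of_isHomogeneous_two hg
    rw [hdiff]
    intro h
    have h100 := congrArg (eval ![1, 0, 0]) h
    have h101 := congrArg (eval ![1, 0, 1]) h
    have h110 := congrArg (eval ![1, 1, 0]) h
    simp at h100 h101 h110
    have ha : a = 0 := by simpa [h100, hn2, hn3] using h101
    have hb : b = 0 := by simpa [h100, ha, hn2] using h110
    have hp : p = -(c / 2) * (n + 3) := by linear_combination h100 / 2
    refine ⟨c / 2, q, r, ?_⟩
    have hc : (C c : MvPolynomial (Fin 3) ℂ) = C (c / 2) * 2 := by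
      rw [← hC, ← C_mul, div_mul_cancel₀ c two_ne_zero]
    rw [ha, hb, hp, hc]
    simp [smul_eq_C_mul, hC]
    ring
  · rintro ⟨u, v, w, rfl⟩
    have h := hdiff 0 0 (2 * u) (-u * (n + 3)) v w
    rw [show 2 * u * (n + 3) + 2 * (-u * (n + 3)) = 0 by ring] at h
    simp only [C_0, zero_mul, zero_add] at h
    rw [← h]
    congr 1
    simp [smul_eq_C_mul, hC]
    ring
end

section
/- Let d ≥ 4, f₃ = x₀^{d-2}x₁² + x₀^{d-1}x₂ ∈ ℂ[x₀,x₁,x₂], and let t be an integer with 2 ≤ t ≤ d−2. A homogeneous polynomial g of degree t in ℂ[y₀,y₁,y₂] annihilates f₃ (i.e. g(∂₀,∂₁,∂₂)f₃ = 0) if and only if g belongs to the ideal generated by the three quadrics 2y₀y₂ − (d−1)y₁², y₁y₂, y₂². -/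
open MvPolynomial

theorem commute_pderiv {σ R : Type*} [CommRing R] (i j : σ) :
    Commute ((pderiv i).toLinearMap : Module.End R (MvPolynomial σ R))
      (pderiv j).toLinearMap := by
  classical
  have h : ⁅pderiv (R := R) i, pderiv (R := R) j⁆ = 0 := by
    refine derivation_ext fun k => ?_
    rw [Derivation.commutator_apply, pderiv_X, pderiv_X]
    simp only [Pi.single_apply]
    split_ifs <;> simp
  refine LinearMap.ext fun p => ?_
  have hp := DFunLike.congr_fun h p
  rw [Derivation.commutator_apply, Derivation.zero_apply, sub_eq_zero] at hp
  exact hp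

/-- The differential operator `∂₀ᵃ ∂₁ᵇ ∂₂ᶜ` for the exponent vector `m = (a, b, c)`. -/
noncomputable def monomialDiffOp (m : Fin 3 →₀ ℕ) : Module.End ℂ (MvPolynomial (Fin 3) ℂ) :=
  (pderiv 0).toLinearMap ^ m 0 * ((pderiv 1).toLinearMap ^ m 1 * (pderiv 2).toLinearMap ^ m 2)

theorem monomialDiffOp_add (m k : Fin 3 →₀ ℕ) :
    monomialDiffOp (m + k) = monomialDiffOp m * monomialDiffOp k := by
  have h (i j : Fin 3) (a b : ℕ) :=
    ((commute_pderiv (R := ℂ) i j).pow_pow a b)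
  simp only [monomialDiffOp, Finsupp.add_apply, pow_add]
  generalize hA : (pderiv (R := ℂ) (0 : Fin 3)).toLinearMap = A at *
  generalize hB : (pderiv (R := ℂ) (1 : Fin 3)).toLinearMap = B at *
  generalize hD : (pderiv (R := ℂ) (2 : Fin 3)).toLinearMap = D at *
  have h10 : B ^ m 1 * A ^ k 0 = A ^ k 0 * B ^ m 1 := hA ▸ hB ▸ (h 1 0 _ _).eq
  have h20 : D ^ m 2 * A ^ k 0 = A ^ k 0 * D ^ m 2 := hA ▸ hD ▸ (h 2 0 _ _).eq
  have h21 : D ^ m 2 * B ^ k 1 = B ^ k 1 * D ^ m 2 := hB ▸ hD ▸ (h 2 1 _ _).eq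
  calc _ = A ^ m 0 * A ^ k 0 * (B ^ m 1 * (B ^ k 1 * D ^ m 2) * D ^ k 2) := by
        simp only [mul_assoc]
    _ = A ^ m 0 * (A ^ k 0 * B ^ m 1) * (D ^ m 2 * B ^ k 1) * D ^ k 2 := by
        rw [h21]; simp only [mul_assoc]
    _ = A ^ m 0 * B ^ m 1 * (A ^ k 0 * D ^ m 2) * B ^ k 1 * D ^ k 2 := by
        rw [← h10]; simp only [mul_assoc]
    _ = _ := by rw [← h20]; simp only [mul_assoc]

/-- The linear map `g ↦ g(∂₀, ∂₁, ∂₂)`. -/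
noncomputable def diffOpLinear :
    MvPolynomial (Fin 3) ℂ →ₗ[ℂ] Module.End ℂ (MvPolynomial (Fin 3) ℂ) :=
  (basisMonomials (Fin 3) ℂ).constr ℂ monomialDiffOp

theorem diffOpLinear_monomial (m : Fin 3 →₀ ℕ) (c : ℂ) :
    diffOpLinear (monomial m c) = c • monomialDiffOp m := by
  have h := (basisMonomials (Fin 3) ℂ).constr_basis ℂ monomialDiffOp m
  rw [coe_basisMonomials] at h
  rw [← mul_one c, ← smul_eq_mul, ← smul_monomial, map_smul, smul_eq_mul, mul_one]
  exact congrArg (c • ·) h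

theorem diffOp_eq_diffOpLinear (g f : MvPolynomial (Fin 3) ℂ) :
    diffOp g f = diffOpLinear g f := by
  conv_rhs => rw [g.as_sum, map_sum, LinearMap.sum_apply]
  refine Finset.sum_congr rfl fun m _ => ?_
  rw [diffOpLinear_monomial, LinearMap.smul_apply]
  simp [monomialDiffOp, List.ofFn_succ]

theorem diffOpLinear_mul (g h : MvPolynomial (Fin 3) ℂ) :
    diffOpLinear (g * h) = diffOpLinear g * diffOpLinear h := by
  induction g using MvPolynomial.induction_on' with
  | add p q hp hq => rw [add_mul, map_add, map_add, hp, hq, add_mul]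
  | monomial m a =>
    induction h using MvPolynomial.induction_on' with
    | add p q hp hq => rw [mul_add, map_add, map_add, hp, hq, mul_add]
    | monomial k b =>
      rw [monomial_mul, diffOpLinear_monomial, diffOpLinear_monomial, diffOpLinear_monomial,
        monomialDiffOp_add, smul_mul_smul_comm]

theorem diffOpLinear_C (c : ℂ) : diffOpLinear (C c) = c • 1 := by
  rw [C_apply, diffOpLinear_monomial]
  simp [monomialDiffOp]

theorem diffOpLinear_X (i : Fin 3) : diffOpLinear (X i) = (pderiv i).toLinearMap := by
  rw [X, diffOpLinear_monomial]
  fin_cases i <;> simp [monomialDiffOp]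

theorem diffOpLinear_X_pow (i : Fin 3) (n : ℕ) :
    diffOpLinear (X i ^ n) = (pderiv i).toLinearMap ^ n := by
  induction n with
  | zero => simpa using diffOpLinear_C 1
  | succ n ih => rw [pow_succ, diffOpLinear_mul, ih, diffOpLinear_X, pow_succ]

theorem pderiv_pow_X_pow_mul {σ R : Type*} [CommRing R] (i : σ) (p : MvPolynomial σ R)
    (hp : pderiv i p = 0) (k n : ℕ) :
    ((pderiv i).toLinearMap ^ n : Module.End R (MvPolynomial σ R)) (X i ^ k * p) =
      (k.descFactorial n : R) • (X i ^ (k - n) * p) := by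
  induction n with
  | zero => simp
  | succ n ih =>
    rw [pow_succ', Module.End.mul_apply, ih, map_smul, Nat.descFactorial_succ, Nat.cast_mul,
      mul_comm ((k - n : ℕ) : R), mul_smul]
    congr 1
    change pderiv i (X i ^ (k - n) * p) = _
    rw [pderiv_mul, hp, pderiv_pow, pderiv_X_self, Nat.sub_sub, smul_eq_C_mul]
    simp [mul_assoc]

/-- The ideal of the three quadrics `2y₀y₂ - (d-1)y₁²`, `y₁y₂`, `y₂²`. -/
noncomputable def quadricIdeal (d : ℕ) : Ideal (MvPolynomial (Fin 3) ℂ) :=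
  Ideal.span {2 * (X 0 * X 2) - C ((d : ℂ) - 1) * X 1 ^ 2, X 1 * X 2, X 2 ^ 2}

theorem diffOpLinear_eq_zero_of_mem_quadricIdeal {d : ℕ} (hd : 2 ≤ d)
    {g : MvPolynomial (Fin 3) ℂ} (hg : g ∈ quadricIdeal d) :
    diffOpLinear g (X 0 ^ (d - 2) * X 1 ^ 2 + X 0 ^ (d - 1) * X 2) = 0 := by
  refine Submodule.span_induction (p := fun g _ =>
    diffOpLinear g (X 0 ^ (d - 2) * X 1 ^ 2 + X 0 ^ (d - 1) * X 2) = 0) ?_ ?_ ?_ ?_ hg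
  · obtain ⟨e, rfl⟩ := Nat.exists_eq_add_of_le' hd
    have h2 : (2 : MvPolynomial (Fin 3) ℂ) = C 2 := (map_ofNat C 2).symm
    rintro q (rfl | rfl | rfl)
    · have hc : ((e + 2 : ℕ) : ℂ) - 1 = e + 1 := by push_cast; ring
      rw [h2, hc, map_sub, diffOpLinear_mul, diffOpLinear_mul, diffOpLinear_mul, diffOpLinear_C,
        diffOpLinear_C, diffOpLinear_X_pow, diffOpLinear_X, diffOpLinear_X]
      simp [pow_two, pderiv_X, smul_eq_C_mul, ← h2]
      ring
    · simp [diffOpLinear_mul, diffOpLinear_X, pderiv_X]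
    · simp [diffOpLinear_mul, diffOpLinear_X, pow_two, pderiv_X]
  · simp
  · intro p q _ _ hp hq
    rw [map_add diffOpLinear, LinearMap.add_apply, hp, hq, add_zero]
  · intro a p _ hp
    rw [smul_eq_mul, diffOpLinear_mul, Module.End.mul_apply, hp, map_zero]

theorem X_one_pow_two_sub_mem_quadricIdeal {d : ℕ} (hd : 2 ≤ d) :
    (X 1 ^ 2 - C (2 / ((d : ℂ) - 1)) * (X 0 * X 2) : MvPolynomial (Fin 3) ℂ) ∈
      quadricIdeal d := by
  have hd' : (d : ℂ) - 1 ≠ 0 := by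
    rw [sub_ne_zero]
    exact_mod_cast (by omega : d ≠ 1)
  have hq : (2 * (X 0 * X 2) - C ((d : ℂ) - 1) * X 1 ^ 2 : MvPolynomial (Fin 3) ℂ) ∈
      quadricIdeal d := Ideal.subset_span (by simp)
  have h2 : (2 : MvPolynomial (Fin 3) ℂ) = C 2 := (map_ofNat C 2).symm
  have hinv : (C ((d : ℂ) - 1)⁻¹ * C ((d : ℂ) - 1) : MvPolynomial (Fin 3) ℂ) = 1 := by
    rw [← C_mul, inv_mul_cancel₀ hd', C_1]
  convert (quadricIdeal d).mul_mem_left (-C ((d : ℂ) - 1)⁻¹) hq using 1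
  rw [div_eq_mul_inv, C_mul, ← h2]
  linear_combination (-X 1 ^ 2) * hinv

theorem X_one_pow_three_mem_quadricIdeal {d : ℕ} (hd : 2 ≤ d) :
    (X 1 ^ 3 : MvPolynomial (Fin 3) ℂ) ∈ quadricIdeal d := by
  have h12 : (X 1 * X 2 : MvPolynomial (Fin 3) ℂ) ∈ quadricIdeal d :=
    Ideal.subset_span (by simp)
  convert add_mem ((quadricIdeal d).mul_mem_left (X 1) (X_one_pow_two_sub_mem_quadricIdeal hd))
    ((quadricIdeal d).mul_mem_left (C (2 / ((d : ℂ) - 1)) * X 0) h12) using 1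
  ring

/-- The sum of the ideal of quadrics and the span of `y₀ᵗ`, `y₀ᵗ⁻¹y₁`, `y₀ᵗ⁻¹y₂`. -/
noncomputable def quadricIdealSupSpan (d t : ℕ) : Submodule ℂ (MvPolynomial (Fin 3) ℂ) :=
  (quadricIdeal d).restrictScalars ℂ ⊔
    Submodule.span ℂ {X 0 ^ t, X 0 ^ (t - 1) * X 1, X 0 ^ (t - 1) * X 2}

theorem X_pow_mul_mem_quadricIdealSupSpan {d : ℕ} (hd : 2 ≤ d) (i j k : ℕ) :
    (X 0 ^ i * X 1 ^ j * X 2 ^ k : MvPolynomial (Fin 3) ℂ) ∈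
      quadricIdealSupSpan d (i + j + k) := by
  have hI {p : MvPolynomial (Fin 3) ℂ} {t : ℕ} (hp : p ∈ quadricIdeal d) :
      p ∈ quadricIdealSupSpan d t := Submodule.mem_sup_left hp
  have h12 : (X 1 * X 2 : MvPolynomial (Fin 3) ℂ) ∈ quadricIdeal d :=
    Ideal.subset_span (by simp)
  have h22 : (X 2 ^ 2 : MvPolynomial (Fin 3) ℂ) ∈ quadricIdeal d :=
    Ideal.subset_span (by simp)
  match j, k with
  | 0, 0 => exact Submodule.mem_sup_right (Submodule.subset_span (by simp))
  | 1, 0 => exact Submodule.mem_sup_right (Submodule.subset_span (by simp))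
  | 0, 1 => exact Submodule.mem_sup_right (Submodule.subset_span (by simp))
  | 2, 0 =>
    have hs : (X 0 ^ (i + 1) * X 2 : MvPolynomial (Fin 3) ℂ) ∈
        quadricIdealSupSpan d (i + 2 + 0) :=
      Submodule.mem_sup_right (Submodule.subset_span (by simp))
    convert add_mem (hI ((quadricIdeal d).mul_mem_left (X 0 ^ i)
      (X_one_pow_two_sub_mem_quadricIdeal hd)))
      (Submodule.smul_mem _ (2 / ((d : ℂ) - 1)) hs) using 1
    rw [smul_eq_C_mul]
    ring
  | j + 3, 0 =>
    convert hI ((quadricIdeal d).mul_mem_left (X 0 ^ i * X 1 ^ j)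
      (X_one_pow_three_mem_quadricIdeal hd)) using 1
    ring
  | j + 1, 1 =>
    convert hI ((quadricIdeal d).mul_mem_left (X 0 ^ i * X 1 ^ j) h12) using 1
    ring
  | j, k + 2 =>
    convert hI ((quadricIdeal d).mul_mem_left (X 0 ^ i * X 1 ^ j * X 2 ^ k) h22) using 1
    ring

theorem exists_sub_mem_quadricIdeal {d t : ℕ} (hd : 2 ≤ d)
    {g : MvPolynomial (Fin 3) ℂ} (hg : g.IsHomogeneous t) :
    ∃ a b c : ℂ, g - (a • X 0 ^ t + b • (X 0 ^ (t - 1) * X 1) +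
      c • (X 0 ^ (t - 1) * X 2)) ∈ quadricIdeal d := by
  have hmem : g ∈ quadricIdealSupSpan d t := by
    rw [g.as_sum]
    refine sum_mem fun m hm => ?_
    have hdeg : m 0 + m 1 + m 2 = t := by
      rw [hg.degree_eq_sum_deg_support hm, ← Finsupp.degree_apply, Finsupp.degree_eq_sum,
        Fin.sum_univ_three]
    have hmon : monomial m (coeff m g) =
        coeff m g • (X 0 ^ m 0 * X 1 ^ m 1 * X 2 ^ m 2 : MvPolynomial (Fin 3) ℂ) := by
      rw [monomial_eq, Finsupp.prod_fintype _ _ (by simp), Fin.prod_univ_three, smul_eq_C_mul]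
    rw [hmon, ← hdeg]
    exact Submodule.smul_mem _ _ (X_pow_mul_mem_quadricIdealSupSpan hd _ _ _)
  obtain ⟨p, hp, q, hq, rfl⟩ := Submodule.mem_sup.1 hmem
  obtain ⟨a, b, c, rfl⟩ := Submodule.mem_span_triple.1 hq
  exact ⟨a, b, c, by simpa using hp⟩

theorem eq_zero_of_diffOpLinear_eq_zero {d t : ℕ} (ht : t ≤ d - 2) {a b c : ℂ}
    (h : diffOpLinear (a • X 0 ^ t + b • (X 0 ^ (t - 1) * X 1) + c • (X 0 ^ (t - 1) * X 2))
      (X 0 ^ (d - 2) * X 1 ^ 2 + X 0 ^ (d - 1) * X 2) = 0) :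
    a = 0 ∧ b = 0 ∧ c = 0 := by
  have h0 (n k : ℕ) (p : MvPolynomial (Fin 3) ℂ) (hp : pderiv 0 p = 0) :=
    pderiv_pow_X_pow_mul 0 p hp k n
  have e1 : diffOpLinear (X 0 ^ t) (X 0 ^ (d - 2) * X 1 ^ 2 + X 0 ^ (d - 1) * X 2) =
      ((d - 2).descFactorial t : ℂ) • (X 0 ^ (d - 2 - t) * X 1 ^ 2) +
      ((d - 1).descFactorial t : ℂ) • (X 0 ^ (d - 1 - t) * X 2) := by
    rw [diffOpLinear_X_pow, map_add, h0 _ _ _ (by simp [pderiv_X]),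
      h0 _ _ _ (by simp [pderiv_X])]
  have e2 : diffOpLinear (X 0 ^ (t - 1) * X 1)
      (X 0 ^ (d - 2) * X 1 ^ 2 + X 0 ^ (d - 1) * X 2) =
      ((d - 2).descFactorial (t - 1) : ℂ) • (X 0 ^ (d - 2 - (t - 1)) * (2 * X 1)) := by
    have : pderiv 1 (X 0 ^ (d - 2) * X 1 ^ 2 + X 0 ^ (d - 1) * X 2 : MvPolynomial (Fin 3) ℂ) =
        X 0 ^ (d - 2) * (2 * X 1) := by
      simp [pderiv_X]
    rw [diffOpLinear_mul, diffOpLinear_X_pow, diffOpLinear_X, Module.End.mul_apply]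
    rw [Derivation.coeFn_coe, this, h0 _ _ _ (by simp [pderiv_X, two_mul])]
  have e3 : diffOpLinear (X 0 ^ (t - 1) * X 2)
      (X 0 ^ (d - 2) * X 1 ^ 2 + X 0 ^ (d - 1) * X 2) =
      ((d - 1).descFactorial (t - 1) : ℂ) • X 0 ^ (d - 1 - (t - 1)) := by
    have : pderiv 2 (X 0 ^ (d - 2) * X 1 ^ 2 + X 0 ^ (d - 1) * X 2 : MvPolynomial (Fin 3) ℂ) =
        X 0 ^ (d - 1) * 1 := by
      simp [pderiv_X]
    rw [diffOpLinear_mul, diffOpLinear_X_pow, diffOpLinear_X, Module.End.mul_apply]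
    rw [Derivation.coeFn_coe, this, h0 _ _ _ (by simp), mul_one]
  have n1 : ((d - 1).descFactorial t : ℂ) ≠ 0 := by
    exact_mod_cast (Nat.descFactorial_pos.2 (by omega)).ne'
  have n2 : ((d - 2).descFactorial (t - 1) : ℂ) ≠ 0 := by
    exact_mod_cast (Nat.descFactorial_pos.2 (by omega)).ne'
  have n3 : ((d - 1).descFactorial (t - 1) : ℂ) ≠ 0 := by
    exact_mod_cast (Nat.descFactorial_pos.2 (by omega)).ne'
  rw [map_add diffOpLinear, map_add diffOpLinear, map_smul, map_smul, map_smul,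
    LinearMap.add_apply, LinearMap.add_apply, LinearMap.smul_apply, LinearMap.smul_apply,
    LinearMap.smul_apply, e1, e2, e3] at h
  have hev (u v w : ℂ) := congrArg (eval ![u, v, w]) h
  simp only [map_add, smul_eval, map_mul, map_pow, eval_X, map_ofNat, map_zero,
    Matrix.cons_val] at hev
  have hc : c = 0 := by simpa [n3] using hev 1 0 0
  have ha : a = 0 := by simpa [n1, hc] using hev 1 0 1
  have hb : b = 0 := by simpa [n2, ha, hc] using hev 1 1 0
  exact ⟨ha, hb, hc⟩

theorem stmt_3 (d : ℕ) (hd : 4 ≤ d)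
    (f₃ : MvPolynomial (Fin 3) ℂ) (hf₃ : f₃ = X 0 ^ (d - 2) * X 1 ^ 2 + X 0 ^ (d - 1) * X 2)
    (t : ℕ) (ht : 2 ≤ t) (ht' : t ≤ d - 2)
    (g : MvPolynomial (Fin 3) ℂ) (hg : g.IsHomogeneous t) :
    diffOp g f₃ = 0 ↔
      g ∈ Ideal.span
        ({2 * (X 0 * X 2) - C ((d : ℂ) - 1) * X 1 ^ 2, X 1 * X 2, X 2 ^ 2} :
          Set (MvPolynomial (Fin 3) ℂ)) := by
  subst hf₃
  rw [diffOp_eq_diffOpLinear]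
  refine ⟨fun h => ?_, diffOpLinear_eq_zero_of_mem_quadricIdeal (by omega)⟩
  obtain ⟨a, b, c, hsub⟩ := exists_sub_mem_quadricIdeal (d := d) (by omega) hg
  have hnf := diffOpLinear_eq_zero_of_mem_quadricIdeal (by omega) hsub
  rw [map_sub diffOpLinear, LinearMap.sub_apply, h, zero_sub, neg_eq_zero] at hnf
  obtain ⟨rfl, rfl, rfl⟩ := eq_zero_of_diffOpLinear_eq_zero ht' hnf
  simpa [quadricIdeal] using hsub
end

section
/- Let I be the ideal of T = ℂ[y₀,y₁,y₂] generated by the three quadrics y₀y₂, y₁², y₁y₂, and consider the square I². Then for every integer d ≥ 4 the degree-d homogeneous component of I² has ℂ-dimension equal to C(d+2,2) − 9, while for d ≤ 3 the degree-d homogeneous component of I² is zero. -/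
open MvPolynomial

/-- The exponents of the monomials in the square of the ideal `(y₀y₂, y₁², y₁y₂)`. -/
def IsSquareExponent (m : Fin 3 →₀ ℕ) : Prop :=
  (2 ≤ m 0 ∧ 2 ≤ m 2) ∨ 4 ≤ m 1 ∨ (2 ≤ m 1 ∧ 2 ≤ m 2) ∨ (1 ≤ m 0 ∧ 2 ≤ m 1 ∧ 1 ≤ m 2) ∨
    (1 ≤ m 0 ∧ 1 ≤ m 1 ∧ 2 ≤ m 2) ∨ (3 ≤ m 1 ∧ 1 ≤ m 2)

open scoped Pointwise in
/-- The product of two ideals generated by monomials is generated by the products of the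
generating monomials. -/
theorem span_monomial_image_mul {σ R : Type*} [CommSemiring R] (s t : Set (σ →₀ ℕ)) :
    Ideal.span ((fun e => monomial e (1 : R)) '' s) *
        Ideal.span ((fun e => monomial e (1 : R)) '' t) =
      Ideal.span ((fun e => monomial e (1 : R)) '' (s + t)) := by
  rw [Ideal.span_mul_span']
  congr 1
  ext p
  simp only [Set.mem_mul, Set.mem_image, Set.mem_add]
  constructor
  · rintro ⟨_, ⟨a, ha, rfl⟩, _, ⟨b, hb, rfl⟩, rfl⟩
    exact ⟨a + b, ⟨a, ha, b, hb, rfl⟩, by simp [monomial_mul]⟩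
  · rintro ⟨_, ⟨a, ha, b, hb, rfl⟩, rfl⟩
    exact ⟨_, ⟨a, ha, rfl⟩, _, ⟨b, hb, rfl⟩, by simp [monomial_mul]⟩

theorem mem_span_sq_iff (p : MvPolynomial (Fin 3) ℂ) :
    p ∈ Ideal.span ({X 0 * X 2, X 1 ^ 2, X 1 * X 2} : Set (MvPolynomial (Fin 3) ℂ)) ^ 2 ↔
      ∀ m ∈ p.support, IsSquareExponent m := by
  have generators : ({X 0 * X 2, X 1 ^ 2, X 1 * X 2} : Set (MvPolynomial (Fin 3) ℂ)) =
      (fun e => monomial e (1 : ℂ)) '' {Finsupp.single 0 1 + Finsupp.single 2 1,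
        Finsupp.single 1 2, Finsupp.single 1 1 + Finsupp.single 2 1} := by
    simp [Set.image_insert_eq, X, monomial_mul, monomial_pow]
  rw [generators, sq, span_monomial_image_mul, mem_ideal_span_monomial_image]
  refine forall₂_congr fun m _ => ?_
  simp only [Set.mem_add, Set.mem_insert_iff, Set.mem_singleton_iff, exists_eq_left,
    or_and_right, exists_or, Finsupp.le_def, Fin.forall_fin_succ, IsSquareExponent]
  simp [Finsupp.single_apply]
  omega

theorem restrictScalars_span_sq_inf_homogeneousSubmodule (d : ℕ) :
    Submodule.restrictScalars ℂ
        (Ideal.span ({X 0 * X 2, X 1 ^ 2, X 1 * X 2} : Set (MvPolynomial (Fin 3) ℂ)) ^ 2) ⊓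
      homogeneousSubmodule (Fin 3) ℂ d =
    restrictSupport ℂ {m | IsSquareExponent m ∧ m.degree = d} := by
  ext p
  rw [Submodule.mem_inf, Submodule.restrictScalars_mem, mem_span_sq_iff,
    homogeneousSubmodule_eq_finsupp_supported, ← restrictSupport, mem_restrictSupport_iff,
    mem_restrictSupport_iff]
  exact Set.subset_inter_iff.symm

theorem degree_fin_three (m : Fin 3 →₀ ℕ) : m.degree = m 0 + m 1 + m 2 := by
  rw [Finsupp.degree_eq_sum, Fin.sum_univ_three]

open scoped Classical in
theorem card_not_isSquareExponent {d : ℕ} (hd : 4 ≤ d) :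
    ((Finset.univ.finsuppAntidiag d).filter
      fun m : Fin 3 →₀ ℕ => ¬ IsSquareExponent m).card = 9 := by
  have hcard : ({(0, 0), (0, 1), (0, d - 1), (0, d), (1, 0), (1, 1), (1, d - 1), (2, 0),
      (3, 0)} : Finset (ℕ × ℕ)).card = 9 := by
    repeat rw [Finset.card_insert_of_notMem (by simp; try omega)]
    simp
  rw [← hcard]
  refine Finset.card_nbij' (fun m => (m 1, m 2))
    (fun q => Finsupp.equivFunOnFinite.symm ![d - q.1 - q.2, q.1, q.2]) ?_ ?_ ?_ ?_
  · intro m hm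
    simp [Fin.sum_univ_three, IsSquareExponent] at hm ⊢
    omega
  · rintro ⟨b, c⟩ hq
    simp [Fin.sum_univ_three, IsSquareExponent] at hq ⊢
    omega
  · intro m hm
    simp [Fin.sum_univ_three] at hm
    ext i
    fin_cases i <;> simp
    omega
  · rintro ⟨b, c⟩ _
    simp

open scoped Classical in
theorem ncard_isSquareExponent {d : ℕ} (hd : 4 ≤ d) :
    {m : Fin 3 →₀ ℕ | IsSquareExponent m ∧ m.degree = d}.ncard = (d + 2).choose 2 - 9 := by
  have hset : {m : Fin 3 →₀ ℕ | IsSquareExponent m ∧ m.degree = d} =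
      ((Finset.univ.finsuppAntidiag d).filter IsSquareExponent : Finset (Fin 3 →₀ ℕ)) := by
    ext m
    simp [Finsupp.degree_eq_sum, and_comm]
  have htotal : (Finset.univ.finsuppAntidiag d : Finset (Fin 3 →₀ ℕ)).card =
      (d + 2).choose 2 := by
    rw [Finset.card_finsuppAntidiag_nat_eq_choose, ← Nat.choose_symm_add]
    simp [add_comm]
  have hsplit := Finset.card_filter_add_card_filter_not
    (s := (Finset.univ.finsuppAntidiag d : Finset (Fin 3 →₀ ℕ))) IsSquareExponent
  rw [card_not_isSquareExponent hd, htotal] at hsplit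
  rw [hset, Set.ncard_coe_finset]
  omega

theorem stmt_4 (I : Ideal (MvPolynomial (Fin 3) ℂ))
    (hI : I = Ideal.span ({X 0 * X 2, X 1 ^ 2, X 1 * X 2} : Set (MvPolynomial (Fin 3) ℂ)))
    (d : ℕ) :
    (4 ≤ d →
      Module.finrank ℂ
        ↥(Submodule.restrictScalars ℂ (I ^ 2 : Ideal (MvPolynomial (Fin 3) ℂ)) ⊓
            homogeneousSubmodule (Fin 3) ℂ d) = Nat.choose (d + 2) 2 - 9) ∧
    (d ≤ 3 →
      Submodule.restrictScalars ℂ (I ^ 2 : Ideal (MvPolynomial (Fin 3) ℂ)) ⊓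
          homogeneousSubmodule (Fin 3) ℂ d = ⊥) := by
  subst hI
  rw [restrictScalars_span_sq_inf_homogeneousSubmodule]
  refine ⟨fun hd => ?_, fun hd => ?_⟩
  · rw [Module.finrank_eq_nat_card_basis (basisRestrictSupport ℂ _), Nat.card_coe_set_eq,
      ncard_isSquareExponent hd]
  · have hempty : {m : Fin 3 →₀ ℕ | IsSquareExponent m ∧ m.degree = d} = ∅ := by
      ext m
      simp only [Set.mem_ofPred_eq, degree_fin_three, IsSquareExponent, Set.mem_empty_iff_false,
        iff_false]
      omega
    rw [hempty, restrictSupport_eq_span, Set.image_empty, Submodule.span_empty]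
end

section
/- Let d ≥ 4 and let I be the ideal of T = ℂ[y₀,y₁,y₂] generated by the three quadrics 2y₀y₂ − (d−1)y₁², y₁y₂, y₂². Then the degree-d homogeneous component of the ideal I² has ℂ-dimension equal to C(d+2,2) − 9. -/
open MvPolynomial

/-- The dimension of the space of forms of degree `d` in finitely many variables. -/
theorem MvPolynomial.finrank_homogeneousSubmodule (σ K : Type*) [Fintype σ] [DecidableEq σ]
    [Field K] (d : ℕ) :
    Module.finrank K (homogeneousSubmodule σ K d) = (Fintype.card σ + d - 1).choose d := by
  rw [homogeneousSubmodule_eq_finsupp_supported,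
    (AddMonoidAlgebra.supportedEquivFinsupp (R := K) (S := K)
      {m : σ →₀ ℕ | m.degree = d}).finrank_eq]
  have hset : {m : σ →₀ ℕ | m.degree = d} =
      ↑(Finset.finsuppAntidiag (Finset.univ : Finset σ) d) := by
    ext m
    simp [Finset.mem_finsuppAntidiag, Finsupp.degree_eq_sum]
  rw [hset]
  simp [Module.finrank_finsupp_self, Finset.card_finsuppAntidiag_nat_eq_choose]

namespace SquareOfQuadrics

/-- The monomial with exponents `a`, `b`, `e`. -/
noncomputable abbrev mon (a b e : ℕ) : MvPolynomial (Fin 3) ℂ := X 0 ^ a * X 1 ^ b * X 2 ^ e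

/-- The three quadrics, with a free parameter `c`. -/
noncomputable abbrev quadrics (c : ℂ) : Set (MvPolynomial (Fin 3) ℂ) :=
  {2 * (X 0 * X 2) - C c * X 1 ^ 2, X 1 * X 2, X 2 ^ 2}

/-- Coordinates of the class of `y₁ ^ b * y₂ ^ e` modulo the square of the ideal of the quadrics,
dehomogenized at `y₀ = 1`, in the basis `1, y₁, y₁², y₁³, y₂, y₁y₂, y₁²y₂, y₂², y₁y₂²`. -/
noncomputable def monCoords (c : ℂ) : ℕ → ℕ → Fin 9 → ℂ
  | 0, 0 => Pi.single 0 1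
  | 1, 0 => Pi.single 1 1
  | 2, 0 => Pi.single 2 1
  | 3, 0 => Pi.single 3 1
  | 0, 1 => Pi.single 4 1
  | 1, 1 => Pi.single 5 1
  | 2, 1 => Pi.single 6 1
  | 0, 2 => Pi.single 7 1
  | 1, 2 => Pi.single 8 1
  | 4, 0 => (4 / c) • Pi.single 6 1 - (4 / c ^ 2) • Pi.single 7 1
  | 5, 0 => (4 / c ^ 2) • Pi.single 8 1
  | 3, 1 => (2 / c) • Pi.single 8 1
  | _, _ => 0

/-- The linear extension of `monCoords` to all polynomials. -/
noncomputable def coords (c : ℂ) : MvPolynomial (Fin 3) ℂ →ₗ[ℂ] Fin 9 → ℂ :=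
  (basisMonomials (Fin 3) ℂ).constr ℂ fun m => monCoords c (m 1) (m 2)

/-- The basis monomials, homogenized to degree `d`. -/
noncomputable def lift (d : ℕ) : (Fin 9 → ℂ) →ₗ[ℂ] MvPolynomial (Fin 3) ℂ :=
  Fintype.linearCombination ℂ ![mon d 0 0, mon (d - 1) 1 0, mon (d - 2) 2 0, mon (d - 3) 3 0,
    mon (d - 1) 0 1, mon (d - 2) 1 1, mon (d - 3) 2 1, mon (d - 2) 0 2, mon (d - 3) 1 2]

theorem monomial_eq_mon (m : Fin 3 →₀ ℕ) : monomial m (1 : ℂ) = mon (m 0) (m 1) (m 2) := by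
  rw [monomial_eq, Finsupp.prod_fintype _ _ (by simp)]
  simp [Fin.prod_univ_three]

theorem coords_mon (c : ℂ) (a b e : ℕ) : coords c (mon a b e) = monCoords c b e := by
  have h := monomial_eq_mon (Finsupp.equivFunOnFinite.symm ![a, b, e])
  simp only [Finsupp.equivFunOnFinite_symm_apply_apply, Matrix.cons_val] at h
  rw [← h, coords, ← congrFun (coe_basisMonomials (Fin 3) ℂ), Module.Basis.constr_basis]
  simp

theorem isHomogeneous_mon (a b e : ℕ) : (mon a b e).IsHomogeneous (a + b + e) :=
  ((isHomogeneous_X_pow 0 a).mul (isHomogeneous_X_pow 1 b)).mul (isHomogeneous_X_pow 2 e)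

theorem lift_single (d : ℕ) (i : Fin 9) :
    lift d (Pi.single i 1) = (![mon d 0 0, mon (d - 1) 1 0, mon (d - 2) 2 0, mon (d - 3) 3 0,
      mon (d - 1) 0 1, mon (d - 2) 1 1, mon (d - 3) 2 1, mon (d - 2) 0 2, mon (d - 3) 1 2] :
      Fin 9 → MvPolynomial (Fin 3) ℂ) i := by
  rw [lift, Fintype.linearCombination_apply_single, one_smul]

theorem coords_lift (c : ℂ) (d : ℕ) (v : Fin 9 → ℂ) : coords c (lift d v) = v := by
  suffices h : coords c ∘ₗ lift d = LinearMap.id from LinearMap.congr_fun h v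
  refine LinearMap.pi_ext' fun i => LinearMap.ext_ring ?_
  simp only [LinearMap.comp_apply, LinearMap.coe_single, lift_single, LinearMap.id_apply]
  fin_cases i <;> simp [-map_mul, coords_mon, monCoords]

theorem lift_mem (d : ℕ) (hd : 4 ≤ d) (v : Fin 9 → ℂ) :
    lift d v ∈ homogeneousSubmodule (Fin 3) ℂ d := by
  rw [lift, Fintype.linearCombination_apply]
  refine Submodule.sum_mem _ fun i _ => Submodule.smul_mem _ _ ?_
  rw [mem_homogeneousSubmodule]
  fin_cases i <;> simp only [Fin.reduceFinMk, Matrix.cons_val] <;>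
    (convert isHomogeneous_mon _ _ _ using 1; omega)

theorem coords_mul_eq_zero {c : ℂ} {g : MvPolynomial (Fin 3) ℂ}
    (h : ∀ a b e, coords c (mon a b e * g) = 0) (p : MvPolynomial (Fin 3) ℂ) :
    coords c (p * g) = 0 := by
  suffices H : coords c ∘ₗ LinearMap.mulRight ℂ g = 0 from LinearMap.congr_fun H p
  refine (basisMonomials (Fin 3) ℂ).ext fun m => ?_
  simp [monomial_eq_mon, -map_mul, h]

theorem monCoords_eq_zero (c : ℂ) {b e : ℕ}
    (h : 3 ≤ e ∨ 2 ≤ e ∧ 2 ≤ b ∨ 1 ≤ e ∧ 4 ≤ b ∨ 6 ≤ b) : monCoords c b e = 0 := by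
  unfold monCoords
  split <;> first | rfl | omega

theorem monCoords_cubic_relation {c : ℂ} (hc : c ≠ 0) (b e : ℕ) :
    (2 : ℂ) • monCoords c (b + 1) (e + 2) - c • monCoords c (b + 3) (e + 1) = 0 := by
  by_cases h : b = 0 ∧ e = 0
  · obtain ⟨rfl, rfl⟩ := h
    simp [monCoords, smul_smul, mul_div_cancel₀ _ hc]
  · rw [monCoords_eq_zero c (by omega), monCoords_eq_zero c (by omega)]
    simp

theorem monCoords_quartic_relation {c : ℂ} (hc : c ≠ 0) (b e : ℕ) :
    (4 : ℂ) • monCoords c b (e + 2) - (4 * c) • monCoords c (b + 2) (e + 1) +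
      c ^ 2 • monCoords c (b + 4) e = 0 := by
  by_cases h : e = 0 ∧ b ≤ 1
  · obtain ⟨rfl, hb⟩ := h
    interval_cases b <;> ext i <;> simp [monCoords] <;> field_simp <;> ring
  · rw [monCoords_eq_zero c (by omega), monCoords_eq_zero c (b := b + 2) (by omega),
      monCoords_eq_zero c (b := b + 4) (by omega)]
    simp

theorem coords_eq_zero_of_mem {c : ℂ} (hc : c ≠ 0) {p : MvPolynomial (Fin 3) ℂ}
    (hp : p ∈ Ideal.span (quadrics c) ^ 2) : coords c p = 0 := by
  suffices H : ∀ q, coords c (q * p) = 0 by simpa using H 1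
  rw [pow_two, Ideal.span_mul_span'] at hp
  induction hp using Submodule.span_induction with
  | zero => simp
  | add x y _ _ hx hy => intro q; rw [mul_add, map_add, hx, hy, add_zero]
  | smul a x _ hx => intro q; rw [smul_eq_mul, ← mul_assoc, hx]
  | mem x hx =>
    refine coords_mul_eq_zero fun a b e => ?_
    have hqq : mon a b e * ((2 * (X 0 * X 2) - C c * X 1 ^ 2) * (2 * (X 0 * X 2) - C c * X 1 ^ 2)) =
        (4 : ℂ) • mon (a + 2) b (e + 2) - (4 * c) • mon (a + 1) (b + 2) (e + 1) +
          c ^ 2 • mon a (b + 4) e := by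
      simp only [smul_eq_C_mul, map_mul, map_pow, map_ofNat]; ring
    have hqyz : mon a b e * ((2 * (X 0 * X 2) - C c * X 1 ^ 2) * (X 1 * X 2)) =
        (2 : ℂ) • mon (a + 1) (b + 1) (e + 2) - c • mon a (b + 3) (e + 1) := by
      simp only [smul_eq_C_mul, map_ofNat]; ring
    have hqzz : mon a b e * ((2 * (X 0 * X 2) - C c * X 1 ^ 2) * X 2 ^ 2) =
        (2 : ℂ) • mon (a + 1) b (e + 3) - c • mon a (b + 2) (e + 2) := by
      simp only [smul_eq_C_mul, map_ofNat]; ring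
    have hyzyz : mon a b e * ((X 1 * X 2) * (X 1 * X 2)) = mon a (b + 2) (e + 2) := by ring
    have hyzzz : mon a b e * ((X 1 * X 2) * X 2 ^ 2) = mon a (b + 1) (e + 3) := by ring
    have hzzzz : mon a b e * (X 2 ^ 2 * X 2 ^ 2) = mon a b (e + 4) := by ring
    replace hqq := congrArg (coords c) hqq
    replace hqyz := congrArg (coords c) hqyz
    replace hqzz := congrArg (coords c) hqzz
    replace hyzyz := congrArg (coords c) hyzyz
    replace hyzzz := congrArg (coords c) hyzzz
    replace hzzzz := congrArg (coords c) hzzzz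
    simp only [map_add, map_sub, map_smul, coords_mon] at hqq hqyz hqzz hyzyz hyzzz hzzzz
    rw [monCoords_quartic_relation hc] at hqq
    rw [monCoords_cubic_relation hc] at hqyz
    rw [monCoords_eq_zero c (by omega), monCoords_eq_zero c (by omega), smul_zero, smul_zero,
      sub_zero] at hqzz
    rw [monCoords_eq_zero c (by omega)] at hyzyz hyzzz hzzzz
    obtain ⟨f, hf, g, hg, rfl⟩ := Set.mem_mul.1 hx
    rcases hf with rfl | rfl | rfl <;> rcases hg with rfl | rfl | rfl
    · exact hqq
    · exact hqyz
    · exact hqzz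
    · convert hqyz using 2; ring
    · exact hyzyz
    · exact hyzzz
    · convert hqzz using 2; ring
    · convert hyzzz using 2; ring
    · exact hzzzz

theorem mon_sub_lift_mem {c : ℂ} (hc : c ≠ 0) {a b e : ℕ} (hd : 4 ≤ a + b + e) :
    mon a b e - lift (a + b + e) (monCoords c b e) ∈ Ideal.span (quadrics c) ^ 2 := by
  set J := Ideal.span (quadrics c) ^ 2 with hJ
  have mul_mem {f g : MvPolynomial (Fin 3) ℂ} (hf : f ∈ quadrics c) (hg : g ∈ quadrics c) :
      f * g ∈ J := by
    rw [hJ, pow_two]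
    exact Ideal.mul_mem_mul (Ideal.subset_span hf) (Ideal.subset_span hg)
  have hq : 2 * (X 0 * X 2) - C c * X 1 ^ 2 ∈ quadrics c := by simp
  have hyz : X 1 * X 2 ∈ quadrics c := by simp
  have hzz : X 2 ^ 2 ∈ quadrics c := by simp
  have hcC : C c⁻¹ * C c = (1 : MvPolynomial (Fin 3) ℂ) := by
    rw [← C_mul, inv_mul_cancel₀ hc, C_1]
  have hC2 : C 2⁻¹ * 2 = (1 : MvPolynomial (Fin 3) ℂ) := by
    rw [← map_ofNat C 2, ← C_mul, inv_mul_cancel₀ two_ne_zero, C_1]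
  have hz4 : mon 0 0 4 ∈ J := by
    convert mul_mem hzz hzz using 1; ring
  have hyz3 : mon 0 1 3 ∈ J := by
    convert mul_mem hyz hzz using 1; ring
  have hy2z2 : mon 0 2 2 ∈ J := by
    convert mul_mem hyz hyz using 1; ring
  have hxz3 : mon 1 0 3 ∈ J := by
    convert J.mul_mem_left (C 2⁻¹)
      (J.add_mem (mul_mem hq hzz) (J.mul_mem_left (C c) hy2z2)) using 1
    linear_combination (-mon 1 0 3) * hC2
  have hy3z : mon 0 3 1 - C (2 / c) * mon 1 1 2 ∈ J := by
    convert J.mul_mem_left (-C c⁻¹) (mul_mem hq hyz) using 1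
    rw [div_eq_mul_inv, C_mul, map_ofNat]
    linear_combination (-mon 0 3 1) * hcC
  have hy4 : mon 0 4 0 - (C (4 / c) * mon 1 2 1 - C (4 / c ^ 2) * mon 2 0 2) ∈ J := by
    convert J.mul_mem_left (C c⁻¹ ^ 2) (mul_mem hq hq) using 1
    simp only [div_eq_mul_inv, C_mul, map_ofNat, ← inv_pow, map_pow]
    linear_combination (4 * C c⁻¹ * mon 1 2 1 - mon 0 4 0 * (C c⁻¹ * C c + 1)) * hcC
  have hy4z : mon 0 4 1 ∈ J := by
    convert J.add_mem (J.mul_mem_left (X 1) hy3z)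
      (J.mul_mem_left (C (2 / c) * X 0) hy2z2) using 1
    ring
  have hy5 : mon 0 5 0 - C (4 / c ^ 2) * mon 2 1 2 ∈ J := by
    convert J.add_mem (J.mul_mem_left (X 1) hy4)
      (J.mul_mem_left (C (4 / c) * X 0) hy3z) using 1
    simp only [div_eq_mul_inv, C_mul, map_ofNat, ← inv_pow, map_pow]
    ring
  have hy6 : mon 0 6 0 ∈ J := by
    convert J.add_mem (J.mul_mem_left (X 1) hy5)
      (J.mul_mem_left (C (4 / c ^ 2) * X 0 ^ 2) hy2z2) using 1
    ring
  have mon_mem {i j k : ℕ} (h : mon i j k ∈ J) (ha : i ≤ a) (hb : j ≤ b) (he : k ≤ e) :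
      mon a b e ∈ J := by
    obtain ⟨a, rfl⟩ := Nat.exists_eq_add_of_le ha
    obtain ⟨b, rfl⟩ := Nat.exists_eq_add_of_le hb
    obtain ⟨e, rfl⟩ := Nat.exists_eq_add_of_le he
    convert J.mul_mem_left (mon a b e) h using 1
    ring
  by_cases h : 3 ≤ e ∨ 2 ≤ e ∧ 2 ≤ b ∨ 1 ≤ e ∧ 4 ≤ b ∨ 6 ≤ b
  · rw [monCoords_eq_zero c h, map_zero, sub_zero]
    rcases h with h | h | h | h
    · by_cases he : 4 ≤ e
      · exact mon_mem hz4 (by omega) (by omega) he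
      by_cases hb : 1 ≤ b
      · exact mon_mem hyz3 (by omega) hb h
      · exact mon_mem hxz3 (by omega) (by omega) h
    · exact mon_mem hy2z2 (by omega) h.2 h.1
    · exact mon_mem hy4z (by omega) h.2 h.1
    · exact mon_mem hy6 (by omega) h (by omega)
  · have he : e < 3 := by omega
    have hb : b < 6 := by omega
    interval_cases e <;> interval_cases b <;>
      try first | omega | (simp [monCoords, lift_single]; done)
    · convert J.mul_mem_left (mon a 0 0) hy4 using 1
      simp only [monCoords, map_sub, map_smul, lift_single, smul_eq_C_mul, Matrix.cons_val,
        add_zero, Nat.reduceSubDiff]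
      ring
    · convert J.mul_mem_left (mon a 0 0) hy5 using 1
      simp only [monCoords, map_smul, lift_single, smul_eq_C_mul, Matrix.cons_val,
        add_zero, Nat.reduceSubDiff]
      ring
    · convert J.mul_mem_left (mon a 0 0) hy3z using 1
      simp only [monCoords, map_smul, lift_single, smul_eq_C_mul, Matrix.cons_val,
        add_assoc, Nat.reduceAdd, Nat.reduceSubDiff]
      ring

theorem sub_lift_coords_mem {c : ℂ} (hc : c ≠ 0) {d : ℕ} (hd : 4 ≤ d)
    {p : MvPolynomial (Fin 3) ℂ} (hp : p.IsHomogeneous d) :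
    p - lift d (coords c p) ∈ Ideal.span (quadrics c) ^ 2 := by
  rw [p.as_sum, map_sum, map_sum, ← Finset.sum_sub_distrib]
  refine Ideal.sum_mem _ fun m hm => ?_
  have hdeg : m 0 + m 1 + m 2 = d := by
    by_contra h
    refine mem_support_iff.1 hm (hp.coeff_eq_zero ?_)
    rwa [Finsupp.degree_eq_sum, Fin.sum_univ_three]
  have hmon : monomial m (coeff m p) = coeff m p • mon (m 0) (m 1) (m 2) := by
    rw [← monomial_eq_mon, smul_monomial, smul_eq_mul, mul_one]
  rw [hmon, map_smul, map_smul, ← smul_sub, coords_mon, ← hdeg]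
  exact Submodule.smul_of_tower_mem _ _ (mon_sub_lift_mem hc (hdeg ▸ hd))

end SquareOfQuadrics

theorem stmt_6 (d : ℕ) (hd : 4 ≤ d)
    (I : Ideal (MvPolynomial (Fin 3) ℂ))
    (hI : I = Ideal.span
      ({2 * (X 0 * X 2) - C ((d : ℂ) - 1) * X 1 ^ 2, X 1 * X 2, X 2 ^ 2} :
        Set (MvPolynomial (Fin 3) ℂ))) :
    Module.finrank ℂ
        ↥(Submodule.restrictScalars ℂ (I ^ 2 : Ideal (MvPolynomial (Fin 3) ℂ)) ⊓
            homogeneousSubmodule (Fin 3) ℂ d) = Nat.choose (d + 2) 2 - 9 := by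
  have hc : (d : ℂ) - 1 ≠ 0 := by
    rw [sub_ne_zero]
    exact_mod_cast (by omega : d ≠ 1)
  set c : ℂ := (d : ℂ) - 1
  let H := homogeneousSubmodule (Fin 3) ℂ d
  have : Module.Finite ℂ H := Module.Finite.iff_fg.2 (homogeneousSubmodule_fg (Fin 3) ℂ d)
  let f : H →ₗ[ℂ] Fin 9 → ℂ := (SquareOfQuadrics.coords c).domRestrict H
  have hf : Function.Surjective f := fun v =>
    ⟨⟨SquareOfQuadrics.lift d v, SquareOfQuadrics.lift_mem d hd v⟩,
      SquareOfQuadrics.coords_lift c d v⟩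
  have hker : (LinearMap.ker f).map H.subtype =
      Submodule.restrictScalars ℂ (I ^ 2 : Ideal (MvPolynomial (Fin 3) ℂ)) ⊓ H := by
    ext p
    simp only [Submodule.mem_map, LinearMap.mem_ker, Submodule.mem_inf,
      Submodule.restrictScalars_mem, hI]
    constructor
    · rintro ⟨⟨p, hp⟩, h0, rfl⟩
      have h := SquareOfQuadrics.sub_lift_coords_mem hc hd hp
      rw [show SquareOfQuadrics.coords c p = 0 from h0, map_zero, sub_zero] at h
      exact ⟨h, hp⟩
    · rintro ⟨h, hp⟩
      exact ⟨⟨p, hp⟩, SquareOfQuadrics.coords_eq_zero_of_mem hc h, rfl⟩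
  have hrank := f.finrank_range_add_finrank_ker
  rw [LinearMap.range_eq_top.2 hf, finrank_top, Module.finrank_fin_fun,
    MvPolynomial.finrank_homogeneousSubmodule, Fintype.card_fin,
    show 3 + d - 1 = d + 2 by omega, Nat.choose_symm_add] at hrank
  rw [← hker, (H.equivSubtypeMap (LinearMap.ker f)).symm.finrank_eq]
  omega
end

section
/- Let n ≥ 2, d ≥ 6, and set s = ⌊d/2⌋. Work in T = ℂ[y₀,y₁,…,yₙ] and let F be either the cubic y₀²y₁ − y₀y₁² or the cubic y₀²y₁, and let K be the ideal (F, y₂,…,yₙ). Then the ℂ-linear span of the set of products {g·h : g ∈ K_s, h ∈ K_{d−s}} has dimension C(d+n,n) − 3n − 3 (that is, C(d+n,n) − 3(n−1) − 6) inside the space T_d of degree-d forms. -/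
open MvPolynomial

/-- The weight on `Fin (k + 2)` that is `0` on the first two variables and `1` on the others. -/
def tailWeight (k : ℕ) (i : Fin (k + 2)) : ℕ := if 2 ≤ (i : ℕ) then 1 else 0

/-- The products `F ^ j * y ^ e` of degree `t` (for `F` a cubic) with at least `r` factors among
`F` and the tail variables. -/
def powerProducts {R : Type*} [CommRing R] {k : ℕ} (F : MvPolynomial (Fin (k + 2)) R) (r t : ℕ) :
    Set (MvPolynomial (Fin (k + 2)) R) :=
  {p | ∃ (j : ℕ) (e : Fin (k + 2) →₀ ℕ), r ≤ j + Finsupp.weight (tailWeight k) e ∧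
    3 * j + e.degree = t ∧ p = F ^ j * monomial e 1}

/-- The exponents of degree `d` that index a basis of `powerProducts F 2 d`. -/
noncomputable def basisExponents (k d : ℕ) : Finset (Fin (k + 2) →₀ ℕ) :=
  (Finset.univ.finsuppAntidiag d).filter
    fun m => 3 * (2 - Finsupp.weight (tailWeight k) m) ≤ m 0

/-- The basis element of `powerProducts F 2 d` attached to an exponent. -/
noncomputable def basisElement {R : Type*} [CommRing R] {k : ℕ} (F : MvPolynomial (Fin (k + 2)) R)
    (m : Fin (k + 2) →₀ ℕ) : MvPolynomial (Fin (k + 2)) R :=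
  F ^ (2 - Finsupp.weight (tailWeight k) m) *
    monomial (m - Finsupp.single 0 (3 * (2 - Finsupp.weight (tailWeight k) m))) 1

section Exponents

variable {k : ℕ}

lemma tailWeight_zero : tailWeight k 0 = 0 := by simp [tailWeight]

lemma tailWeight_one : tailWeight k 1 = 0 := by simp [tailWeight]

lemma weight_single_zero_add (a : ℕ) (e : Fin (k + 2) →₀ ℕ) :
    Finsupp.weight (tailWeight k) (Finsupp.single 0 a + e) = Finsupp.weight (tailWeight k) e := by
  rw [map_add, Finsupp.weight_single, tailWeight_zero, smul_zero, zero_add]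

lemma mem_finsuppAntidiag_univ_iff_degree {d : ℕ} {m : Fin (k + 2) →₀ ℕ} :
    m ∈ Finset.univ.finsuppAntidiag d ↔ m.degree = d := by
  simp [Finset.mem_finsuppAntidiag, Finsupp.degree_eq_sum]

lemma mem_basisExponents {d : ℕ} {m : Fin (k + 2) →₀ ℕ} :
    m ∈ basisExponents k d ↔
      m.degree = d ∧ 3 * (2 - Finsupp.weight (tailWeight k) m) ≤ m 0 := by
  rw [basisExponents, Finset.mem_filter, mem_finsuppAntidiag_univ_iff_degree]

lemma exists_single_add_of_mem_basisExponents {d : ℕ} {m : Fin (k + 2) →₀ ℕ}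
    (hm : m ∈ basisExponents k d) :
    ∃ e, Finsupp.single 0 (3 * (2 - Finsupp.weight (tailWeight k) m)) + e = m ∧
      m - Finsupp.single 0 (3 * (2 - Finsupp.weight (tailWeight k) m)) = e ∧
      Finsupp.weight (tailWeight k) e = Finsupp.weight (tailWeight k) m ∧
      3 * (2 - Finsupp.weight (tailWeight k) m) + e.degree = d := by
  obtain ⟨h₁, h₂⟩ := mem_basisExponents.mp hm
  generalize 3 * (2 - Finsupp.weight (tailWeight k) m) = a at h₂ ⊢
  obtain ⟨e, rfl⟩ := exists_add_of_le (Finsupp.single_le_iff.mpr h₂)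
  refine ⟨e, rfl, add_tsub_cancel_left _ _, (weight_single_zero_add _ _).symm, ?_⟩
  rwa [map_add, Finsupp.degree_single] at h₁

lemma degree_eq_add_tailWeight (m : Fin (k + 2) →₀ ℕ) :
    m.degree = m 0 + m 1 + Finsupp.weight (tailWeight k) m := by
  rw [Finsupp.degree_eq_sum, Finsupp.weight_eq_sum]
  simp [Fin.sum_univ_succ, tailWeight, add_assoc]

lemma exists_eq_add_of_degree_eq_add {σ : Type*} {e : σ →₀ ℕ} {a b : ℕ} (h : e.degree = a + b) :
    ∃ e₁ e₂, e₁ + e₂ = e ∧ e₁.degree = a ∧ e₂.degree = b := by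
  obtain ⟨e₁, hle, h₁⟩ := Finsupp.exists_le_degree_eq e a (by omega)
  obtain ⟨e₂, rfl⟩ := exists_add_of_le hle
  refine ⟨e₁, e₂, rfl, h₁, ?_⟩
  rw [map_add] at h
  omega

lemma exists_single_add_of_tailWeight_pos {e : Fin (k + 2) →₀ ℕ}
    (h : 1 ≤ Finsupp.weight (tailWeight k) e) :
    ∃ (i : Fin (k + 2)) (e' : Fin (k + 2) →₀ ℕ), tailWeight k i = 1 ∧
      e = Finsupp.single i 1 + e' := by
  rw [Finsupp.weight_eq_sum] at h
  obtain ⟨i, -, hi⟩ := Finset.exists_ne_zero_of_sum_ne_zero (Nat.one_le_iff_ne_zero.mp h)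
  obtain ⟨h₁, h₂⟩ := mul_ne_zero_iff.mp hi
  obtain ⟨e', rfl⟩ := exists_add_of_le
    (Finsupp.single_le_iff.mpr (Nat.one_le_iff_ne_zero.mpr h₁))
  refine ⟨i, e', ?_, rfl⟩
  unfold tailWeight at h₂ ⊢
  split_ifs at h₂ ⊢ <;> simp_all

lemma card_tail_indices : (Finset.univ.filter fun i : Fin (k + 2) => 2 ≤ (i : ℕ)).card = k := by
  rw [Finset.card_filter]
  simp only [Fin.sum_univ_succ]
  simp

lemma card_exponents_tailWeight_zero {d : ℕ} (hd : 6 ≤ d) :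
    ((Finset.univ.finsuppAntidiag d).filter fun m : Fin (k + 2) →₀ ℕ =>
      Finsupp.weight (tailWeight k) m = 0 ∧ m 0 < 6).card = 6 := by
  rw [← Finset.card_range 6]
  symm
  refine Finset.card_bij (fun a _ => Finsupp.single 0 a + Finsupp.single 1 (d - a)) ?_ ?_ ?_
  · intro a ha
    rw [Finset.mem_range] at ha
    rw [Finset.mem_filter, mem_finsuppAntidiag_univ_iff_degree]
    simp only [map_add, Finsupp.weight_single, Finsupp.degree_single, tailWeight_zero,
      tailWeight_one, Finsupp.add_apply]
    simp
    omega
  · intro a _ b _ hab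
    simpa using DFunLike.congr_fun hab 0
  · intro m hm
    rw [Finset.mem_filter, mem_finsuppAntidiag_univ_iff_degree] at hm
    obtain ⟨h₁, h₂, h₃⟩ := hm
    refine ⟨m 0, Finset.mem_range.mpr h₃, ?_⟩
    have h₄ := degree_eq_add_tailWeight m
    rw [Finsupp.weight_eq_sum, Finset.sum_eq_zero_iff] at h₂
    ext i
    refine Fin.cases ?_ (Fin.cases ?_ fun i => ?_) i
    · simp
    · have : Finsupp.weight (tailWeight k) m = 0 := by
        rw [Finsupp.weight_eq_sum, Finset.sum_eq_zero_iff]; exact h₂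
      simp
      omega
    · have := h₂ i.succ.succ (Finset.mem_univ _)
      simp [tailWeight] at this
      simp [this, Fin.ext_iff]

lemma card_exponents_tailWeight_one {d : ℕ} (hd : 6 ≤ d) :
    ((Finset.univ.finsuppAntidiag d).filter fun m : Fin (k + 2) →₀ ℕ =>
      Finsupp.weight (tailWeight k) m = 1 ∧ m 0 < 3).card = k * 3 := by
  have hcard : ((Finset.univ.filter fun i : Fin (k + 2) => 2 ≤ (i : ℕ)) ×ˢ
      Finset.range 3).card = k * 3 := by
    rw [Finset.card_product, card_tail_indices, Finset.card_range]
  rw [← hcard]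
  symm
  refine Finset.card_bij (fun x _ => Finsupp.single x.1 1 +
    (Finsupp.single 0 x.2 + Finsupp.single 1 (d - 1 - x.2))) ?_ ?_ ?_
  · rintro ⟨i, a⟩ ha
    simp only [Finset.mem_product, Finset.mem_filter, Finset.mem_univ, true_and,
      Finset.mem_range] at ha
    obtain ⟨hi, ha⟩ := ha
    have hi0 : i ≠ 0 := by rintro rfl; simp at hi
    rw [Finset.mem_filter, mem_finsuppAntidiag_univ_iff_degree]
    have hw : tailWeight k i = 1 := by simp [tailWeight, hi]
    simp only [map_add, Finsupp.weight_single, Finsupp.degree_single, tailWeight_zero,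
      tailWeight_one, hw, Finsupp.add_apply]
    simp [hi0]
    omega
  · rintro ⟨i, a⟩ ha ⟨j, b⟩ hb hab
    simp only [Finset.mem_product, Finset.mem_filter, Finset.mem_univ, true_and,
      Finset.mem_range] at ha hb
    have hi0 : i ≠ 0 := by rintro rfl; simp at ha
    have hj0 : j ≠ 0 := by rintro rfl; simp at hb
    have hi1 : i ≠ 1 := by rintro rfl; simp at ha
    have h0 := DFunLike.congr_fun hab 0
    have h1 := DFunLike.congr_fun hab i
    simp [Finsupp.single_apply, hi0, hj0, hi0.symm, hi1.symm] at h0 h1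
    rw [h0, h1]
  · intro m hm
    rw [Finset.mem_filter, mem_finsuppAntidiag_univ_iff_degree] at hm
    obtain ⟨h₁, h₂, h₃⟩ := hm
    obtain ⟨i, e, hi, rfl⟩ := exists_single_add_of_tailWeight_pos h₂.ge
    have hi2 : 2 ≤ (i : ℕ) := by
      by_contra h
      simp [tailWeight, h] at hi
    have hi0 : i ≠ 0 := by rintro rfl; simp at hi2
    have hw : Finsupp.weight (tailWeight k) e = 0 := by
      simpa [Finsupp.weight_single, hi] using h₂
    have h₄ := degree_eq_add_tailWeight e
    simp [hi0.symm] at h₁ h₃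
    refine ⟨⟨i, e 0⟩, by simpa using ⟨hi2, h₃⟩, ?_⟩
    congr 1
    have hw' := hw
    rw [Finsupp.weight_eq_sum, Finset.sum_eq_zero_iff] at hw'
    ext l
    refine Fin.cases ?_ (Fin.cases ?_ fun l => ?_) l
    · simp
    · simp
      omega
    · have := hw' l.succ.succ (Finset.mem_univ _)
      simp [tailWeight] at this
      simp [this, Fin.ext_iff]

lemma card_basisExponents {d : ℕ} (hd : 6 ≤ d) :
    (basisExponents k d).card = (d + (k + 1)).choose (k + 1) - 3 * (k + 1) - 3 := by
  have htot : (Finset.univ.finsuppAntidiag d : Finset (Fin (k + 2) →₀ ℕ)).card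
      = (d + (k + 1)).choose (k + 1) := by
    rw [Finset.card_finsuppAntidiag_nat_eq_choose, Finset.card_univ, Fintype.card_fin,
      show k + 2 + d - 1 = d + (k + 1) by omega, Nat.choose_symm_add]
  have hsplit := Finset.card_filter_add_card_filter_not
    (s := (Finset.univ.finsuppAntidiag d : Finset (Fin (k + 2) →₀ ℕ)))
    (fun m => 3 * (2 - Finsupp.weight (tailWeight k) m) ≤ m 0)
  have hcompl : ((Finset.univ.finsuppAntidiag d).filter fun m : Fin (k + 2) →₀ ℕ =>
      ¬ 3 * (2 - Finsupp.weight (tailWeight k) m) ≤ m 0).card = 6 + k * 3 := by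
    rw [← card_exponents_tailWeight_zero (k := k) hd, ← card_exponents_tailWeight_one hd,
      ← Finset.card_union_of_disjoint, ← Finset.filter_or]
    · congr 1
      refine Finset.filter_congr fun m _ => ?_
      omega
    · refine Finset.disjoint_filter.mpr fun m _ h => ?_
      omega
  rw [hcompl, htot] at hsplit
  unfold basisExponents
  omega

end Exponents

section Span

variable {k : ℕ}

lemma span_powerProducts_eq_span_basisElement {R : Type*} [CommRing R]
    {F : MvPolynomial (Fin (k + 2)) R} {c : R}
    (hF : F = X 0 ^ 2 * X 1 - C c * (X 0 * X 1 ^ 2)) (d : ℕ) :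
    Submodule.span R (powerProducts F 2 d)
      = Submodule.span R (Set.range fun m : basisExponents k d => basisElement F m) := by
  apply le_antisymm
  · rw [Submodule.span_le]
    rintro _ ⟨j, e, hr, hdeg, rfl⟩
    rw [SetLike.mem_coe]
    induction j generalizing e with
    | zero =>
      refine Submodule.subset_span ⟨⟨e, mem_basisExponents.mpr ⟨by omega, by omega⟩⟩, ?_⟩
      simp [basisElement, show 2 - Finsupp.weight (tailWeight k) e = 0 by omega]
    | succ j ih =>
      by_cases h : j + 1 = 2 - Finsupp.weight (tailWeight k) e
      · have hw : Finsupp.weight (tailWeight k) (e + Finsupp.single 0 (3 * (j + 1)))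
            = Finsupp.weight (tailWeight k) e := by
          rw [add_comm e, weight_single_zero_add]
        refine Submodule.subset_span
          ⟨⟨e + Finsupp.single 0 (3 * (j + 1)), mem_basisExponents.mpr ⟨?_, ?_⟩⟩, ?_⟩
        · rw [map_add, Finsupp.degree_single]
          omega
        · rw [hw, ← h]
          simp
        · simp only [basisElement, hw, ← h, add_tsub_cancel_right]
      · have key : F ^ (j + 1) * monomial e 1
            = F ^ j * monomial (e + (Finsupp.single 0 2 + Finsupp.single 1 1)) 1
              - c • (F ^ j * monomial (e + (Finsupp.single 0 1 + Finsupp.single 1 2)) 1) := by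
          have h₁ : (monomial (e + (Finsupp.single 0 2 + Finsupp.single 1 1)) 1 :
              MvPolynomial (Fin (k + 2)) R) = monomial e 1 * (X 0 ^ 2 * X 1) := by
            simp [X, monomial_mul, monomial_pow]
          have h₂ : (monomial (e + (Finsupp.single 0 1 + Finsupp.single 1 2)) 1 :
              MvPolynomial (Fin (k + 2)) R) = monomial e 1 * (X 0 * X 1 ^ 2) := by
            simp [X, monomial_mul, monomial_pow]
          rw [h₁, h₂, smul_eq_C_mul, pow_succ]
          nth_rewrite 2 [hF]
          ring
        rw [key]
        refine Submodule.sub_mem _ (ih _ ?_ ?_) (Submodule.smul_mem _ _ (ih _ ?_ ?_)) <;>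
        · simp [Finsupp.weight_single, tailWeight_zero, tailWeight_one]
          omega
  · rw [Submodule.span_le]
    rintro _ ⟨⟨m, hm⟩, rfl⟩
    obtain ⟨e, -, hsub, hw, hdeg⟩ := exists_single_add_of_mem_basisExponents hm
    refine Submodule.subset_span ⟨2 - Finsupp.weight (tailWeight k) m, e, by omega, hdeg, ?_⟩
    simp only [basisElement, hsub]

lemma linearIndependent_basisElement {R : Type*} [CommRing R] [IsDomain R]
    {F : MvPolynomial (Fin (k + 2)) R} (hF0 : F ≠ 0)
    (hF : IsWeightedHomogeneous (tailWeight k) F 0) (d : ℕ) :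
    LinearIndependent R fun m : basisExponents k d => basisElement F (m : Fin (k + 2) →₀ ℕ) := by
  classical
  have hhom (m : basisExponents k d) : IsWeightedHomogeneous (tailWeight k)
      (basisElement F (m : Fin (k + 2) →₀ ℕ)) (Finsupp.weight (tailWeight k) m.1) := by
    obtain ⟨m, hm⟩ := m
    obtain ⟨e, -, hsub, hw, -⟩ := exists_single_add_of_mem_basisExponents hm
    have := (hF.pow (2 - Finsupp.weight (tailWeight k) m)).mul
      (isWeightedHomogeneous_monomial (tailWeight k)
        (m - Finsupp.single 0 (3 * (2 - Finsupp.weight (tailWeight k) m))) (1 : R)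
        (m := Finsupp.weight (tailWeight k) m) (by rw [hsub, hw]))
    simpa [basisElement] using this
  rw [Fintype.linearIndependent_iff]
  intro g hg m₀
  set w := Finsupp.weight (tailWeight k) m₀.1 with hw
  have hcomp := congrArg (weightedHomogeneousComponent (tailWeight k) w) hg
  rw [map_sum, map_zero] at hcomp
  have hterm (m : basisExponents k d) :
      weightedHomogeneousComponent (tailWeight k) w (g m • basisElement F m.1)
        = F ^ (2 - w) * (if Finsupp.weight (tailWeight k) m.1 = w then
            monomial (m.1 - Finsupp.single 0 (3 * (2 - w))) (g m) else 0) := by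
    rw [map_smul, weightedHomogeneousComponent_of_mem (hhom m)]
    split_ifs with h₁ h₂ h₂
    · rw [basisElement, h₁, ← mul_smul_comm, smul_monomial, smul_eq_mul, mul_one]
    · exact absurd h₁.symm h₂
    · exact absurd h₂.symm h₁
    · simp
  rw [Finset.sum_congr rfl fun m _ => hterm m, ← Finset.mul_sum] at hcomp
  have hsum := (mul_eq_zero.mp hcomp).resolve_left (pow_ne_zero _ hF0)
  have hcoeff := congrArg (coeff (m₀.1 - Finsupp.single 0 (3 * (2 - w)))) hsum
  rw [coeff_sum, Finset.sum_eq_single m₀] at hcoeff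
  · simpa [← hw] using hcoeff
  · intro m _ hne
    split_ifs with h
    · rw [coeff_monomial, if_neg]
      intro heq
      refine hne (Subtype.ext ?_)
      obtain ⟨e, he, hsub, -⟩ := exists_single_add_of_mem_basisExponents m.2
      obtain ⟨e₀, he₀, hsub₀, -⟩ := exists_single_add_of_mem_basisExponents m₀.2
      rw [h] at he hsub
      rw [← hw] at he₀ hsub₀
      rw [← he, ← he₀, ← hsub, ← hsub₀, heq]
    · simp
  · simp

lemma mem_span_powerProducts_of_mem {R : Type*} [CommRing R]
    {F : MvPolynomial (Fin (k + 2)) R} (hF : F.IsHomogeneous 3) {t : ℕ}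
    {g : MvPolynomial (Fin (k + 2)) R}
    (hg : g ∈ Ideal.span ({F} ∪ {p | ∃ i : Fin (k + 2), 2 ≤ (i : ℕ) ∧ p = X i}))
    (ht : g.IsHomogeneous t) : g ∈ Submodule.span R (powerProducts F 1 t) := by
  rw [← weightedHomogeneousComponent_eq_self ht]
  have htop : Submodule.span R (Set.range fun e : Fin (k + 2) →₀ ℕ => monomial e (1 : R)) = ⊤ := by
    simpa using (basisMonomials (Fin (k + 2)) R).span_eq
  have hg' : g ∈ (Ideal.span
      ({F} ∪ {p | ∃ i : Fin (k + 2), 2 ≤ (i : ℕ) ∧ p = X i})).restrictScalars R := hg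
  rw [Ideal.span, ← Submodule.span_smul_of_span_eq_top htop] at hg'
  clear hg ht
  induction hg' using Submodule.span_induction with
  | zero => simp
  | add x y _ _ hx hy => rw [map_add]; exact add_mem hx hy
  | smul a x _ hx => rw [map_smul]; exact Submodule.smul_mem _ _ hx
  | mem x hx =>
    classical
    obtain ⟨_, ⟨e, rfl⟩, y, hy, rfl⟩ := hx
    have hpp : ∃ u, (monomial e (1 : R) • y).IsHomogeneous u ∧
        monomial e (1 : R) • y ∈ powerProducts F 1 u := by
      rcases hy with rfl | ⟨i, hi, rfl⟩
      · refine ⟨e.degree + 3, (isHomogeneous_monomial 1 rfl).mul hF, 1, e, by omega, by omega, ?_⟩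
        rw [smul_eq_mul, pow_one, mul_comm]
      · refine ⟨e.degree + 1, (isHomogeneous_monomial 1 rfl).mul (isHomogeneous_X R i), 0,
          e + Finsupp.single i 1, ?_, ?_, ?_⟩
        · simp [Finsupp.weight_single, tailWeight, hi]
        · simp
        · simp [X, monomial_mul]
    obtain ⟨u, hu, hmem⟩ := hpp
    dsimp only
    rw [weightedHomogeneousComponent_of_mem hu]
    split_ifs with h
    · exact h ▸ Submodule.subset_span hmem
    · exact zero_mem _

lemma mem_of_mem_powerProducts {R : Type*} [CommRing R]
    {F : MvPolynomial (Fin (k + 2)) R} (hF : F.IsHomogeneous 3) {t : ℕ}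
    {g : MvPolynomial (Fin (k + 2)) R} (hg : g ∈ powerProducts F 1 t) :
    g ∈ Submodule.restrictScalars R
        (Ideal.span ({F} ∪ {p | ∃ i : Fin (k + 2), 2 ≤ (i : ℕ) ∧ p = X i}))
      ⊓ homogeneousSubmodule (Fin (k + 2)) R t := by
  obtain ⟨j, e, hr, hdeg, rfl⟩ := hg
  refine ⟨?_, ?_⟩
  · rw [SetLike.mem_coe, Submodule.restrictScalars_mem]
    rcases Nat.eq_zero_or_pos j with rfl | hj
    · obtain ⟨i, e', hi, rfl⟩ := exists_single_add_of_tailWeight_pos (by simpa using hr)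
      have hi2 : 2 ≤ (i : ℕ) := by
        by_contra h
        simp [tailWeight, h] at hi
      have : (monomial (Finsupp.single i 1 + e') 1 : MvPolynomial (Fin (k + 2)) R)
          = X i * monomial e' 1 := by simp [X, monomial_mul]
      rw [this]
      exact Ideal.mul_mem_left _ _ (Ideal.mul_mem_right _ _
        (Ideal.subset_span (Or.inr ⟨i, hi2, rfl⟩)))
    · refine Ideal.mul_mem_right _ _ (Ideal.pow_mem_of_mem _ (Ideal.subset_span ?_) _ hj)
      exact Or.inl rfl
  · rw [SetLike.mem_coe, mem_homogeneousSubmodule, ← hdeg]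
    exact (hF.pow j).mul (isHomogeneous_monomial 1 rfl)

lemma exists_mul_of_mem_powerProducts_two {R : Type*} [CommRing R]
    {F : MvPolynomial (Fin (k + 2)) R} {a b : ℕ} (ha : 3 ≤ a) (hb : 3 ≤ b)
    {m : Fin (k + 2) →₀ ℕ} {j : ℕ} (hj : j ≤ 2)
    (hr : 2 ≤ j + Finsupp.weight (tailWeight k) m) (hdeg : 3 * j + m.degree = a + b) :
    ∃ g ∈ powerProducts F 1 a, ∃ h ∈ powerProducts F 1 b, F ^ j * monomial m 1 = g * h := by
  suffices H : ∃ j₁ j₂ e₁ e₂, j₁ + j₂ = j ∧ e₁ + e₂ = m ∧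
      1 ≤ j₁ + Finsupp.weight (tailWeight k) e₁ ∧ 3 * j₁ + e₁.degree = a ∧
      1 ≤ j₂ + Finsupp.weight (tailWeight k) e₂ ∧ 3 * j₂ + e₂.degree = b by
    obtain ⟨j₁, j₂, e₁, e₂, rfl, rfl, h₁, h₂, h₃, h₄⟩ := H
    refine ⟨_, ⟨j₁, e₁, h₁, h₂, rfl⟩, _, ⟨j₂, e₂, h₃, h₄, rfl⟩, ?_⟩
    rw [mul_mul_mul_comm, monomial_mul, pow_add, one_mul]
  interval_cases j
  · obtain ⟨i, m, hi, rfl⟩ := exists_single_add_of_tailWeight_pos (e := m) (by omega)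
    simp [Finsupp.weight_single, hi] at hr hdeg
    obtain ⟨i', m, hi', rfl⟩ := exists_single_add_of_tailWeight_pos (e := m) (by omega)
    simp at hdeg
    obtain ⟨e₁, e₂, rfl, h₁, h₂⟩ := exists_eq_add_of_degree_eq_add
      (e := m) (a := a - 1) (b := b - 1) (by omega)
    refine ⟨0, 0, Finsupp.single i 1 + e₁, Finsupp.single i' 1 + e₂, rfl, by abel, ?_⟩
    simp [Finsupp.weight_single, hi, hi']
    omega
  · obtain ⟨i, m, hi, rfl⟩ := exists_single_add_of_tailWeight_pos (e := m) (by omega)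
    simp at hdeg
    obtain ⟨e₁, e₂, rfl, h₁, h₂⟩ := exists_eq_add_of_degree_eq_add
      (e := m) (a := a - 3) (b := b - 1) (by omega)
    refine ⟨1, 0, e₁, Finsupp.single i 1 + e₂, rfl, by abel, ?_⟩
    simp [Finsupp.weight_single, hi]
    omega
  · obtain ⟨e₁, e₂, rfl, h₁, h₂⟩ := exists_eq_add_of_degree_eq_add
      (e := m) (a := a - 3) (b := b - 3) (by omega)
    exact ⟨1, 1, e₁, e₂, rfl, rfl, by omega, by omega, by omega, by omega⟩

lemma span_mul_eq_span_basisElement {R : Type*} [CommRing R]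
    {F : MvPolynomial (Fin (k + 2)) R} {c : R}
    (hF : F = X 0 ^ 2 * X 1 - C c * (X 0 * X 1 ^ 2)) (hF3 : F.IsHomogeneous 3)
    {K : Ideal (MvPolynomial (Fin (k + 2)) R)}
    (hK : K = Ideal.span ({F} ∪ {p | ∃ i : Fin (k + 2), 2 ≤ (i : ℕ) ∧ p = X i}))
    {a b : ℕ} (ha : 3 ≤ a) (hb : 3 ≤ b) :
    Submodule.span R {p | ∃ g ∈ Submodule.restrictScalars R K ⊓ homogeneousSubmodule _ R a,
        ∃ h ∈ Submodule.restrictScalars R K ⊓ homogeneousSubmodule _ R b, p = g * h}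
      = Submodule.span R
        (Set.range fun m : basisExponents k (a + b) => basisElement F m) := by
  subst hK
  apply le_antisymm
  · rw [← span_powerProducts_eq_span_basisElement hF, Submodule.span_le]
    rintro _ ⟨g, ⟨hgK, hga⟩, h, ⟨hhK, hhb⟩, rfl⟩
    have hmul := Submodule.mul_mem_mul (mem_span_powerProducts_of_mem hF3 hgK hga)
      (mem_span_powerProducts_of_mem hF3 hhK hhb)
    rw [Submodule.span_mul_span] at hmul
    refine Submodule.span_mono ?_ hmul
    rintro _ ⟨_, ⟨j₁, e₁, hr₁, hd₁, rfl⟩, _, ⟨j₂, e₂, hr₂, hd₂, rfl⟩, rfl⟩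
    refine ⟨j₁ + j₂, e₁ + e₂, ?_, ?_, ?_⟩
    · rw [map_add]; omega
    · rw [map_add]; omega
    · dsimp only
      rw [mul_mul_mul_comm, monomial_mul, pow_add, one_mul]
  · rw [Submodule.span_le]
    rintro _ ⟨⟨m, hm⟩, rfl⟩
    obtain ⟨e, -, hsub, hw, hdeg⟩ := exists_single_add_of_mem_basisExponents hm
    obtain ⟨g, hg, h, hh, heq⟩ := exists_mul_of_mem_powerProducts_two (F := F) ha hb
      (m := e) (j := 2 - Finsupp.weight (tailWeight k) m) (by omega) (by omega) (by omega)
    refine Submodule.subset_span ⟨g, mem_of_mem_powerProducts hF3 hg, h,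
      mem_of_mem_powerProducts hF3 hh, ?_⟩
    rw [← heq]
    dsimp only
    rw [basisElement, hsub]

end Span

lemma isHomogeneous_cubic {R : Type*} [CommRing R] {k : ℕ} (c : R) :
    (X 0 ^ 2 * X 1 - C c * (X 0 * X 1 ^ 2) : MvPolynomial (Fin (k + 2)) R).IsHomogeneous 3 := by
  refine ((isHomogeneous_X_pow 0 2).mul (isHomogeneous_X R 1)).sub ?_
  simpa using (isHomogeneous_C (Fin (k + 2)) c).mul
    ((isHomogeneous_X R 0).mul (isHomogeneous_X_pow 1 2))

lemma isWeightedHomogeneous_cubic {R : Type*} [CommRing R] {k : ℕ} (c : R) :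
    IsWeightedHomogeneous (tailWeight k) (X 0 ^ 2 * X 1 - C c * (X 0 * X 1 ^ 2)) 0 := by
  have h₀ : IsWeightedHomogeneous (tailWeight k) (X 0 : MvPolynomial (Fin (k + 2)) R) 0 := by
    simpa [tailWeight_zero] using isWeightedHomogeneous_X R (tailWeight k) 0
  have h₁ : IsWeightedHomogeneous (tailWeight k) (X 1 : MvPolynomial (Fin (k + 2)) R) 0 := by
    simpa [tailWeight_one] using isWeightedHomogeneous_X R (tailWeight k) 1
  have := ((h₀.pow 2).mul h₁).sub ((h₀.mul (h₁.pow 2)).C_mul c)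
  simpa using this

lemma cubic_ne_zero {R : Type*} [CommRing R] [CharZero R] {k : ℕ} {c : R} (hc : c = 0 ∨ c = 1) :
    (X 0 ^ 2 * X 1 - C c * (X 0 * X 1 ^ 2) : MvPolynomial (Fin (k + 2)) R) ≠ 0 := by
  intro h
  have := congrArg (eval fun i => if i = 0 then (2 : R) else 1) h
  rcases hc with rfl | rfl <;> norm_num at this

theorem stmt_9 (n : ℕ) (hn : 2 ≤ n) (d : ℕ) (hd : 6 ≤ d) (s : ℕ) (hs : s = d / 2)
    (F : MvPolynomial (Fin (n + 1)) ℂ)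
    (hF : F = X 0 ^ 2 * X 1 - X 0 * X 1 ^ 2 ∨ F = X 0 ^ 2 * X 1)
    (K : Ideal (MvPolynomial (Fin (n + 1)) ℂ))
    (hK : K = Ideal.span
      ({F} ∪ {p : MvPolynomial (Fin (n + 1)) ℂ | ∃ i : Fin (n + 1), 2 ≤ (i : ℕ) ∧ p = X i})) :
    Module.finrank ℂ
        ↥(Submodule.span ℂ
          {p : MvPolynomial (Fin (n + 1)) ℂ |
            ∃ g ∈ Submodule.restrictScalars ℂ K ⊓ homogeneousSubmodule (Fin (n + 1)) ℂ s,
            ∃ h ∈ Submodule.restrictScalars ℂ K ⊓ homogeneousSubmodule (Fin (n + 1)) ℂ (d - s),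
            p = g * h}) = Nat.choose (d + n) n - 3 * n - 3 := by
  obtain ⟨k, rfl⟩ : ∃ k, n = k + 1 := ⟨n - 1, by omega⟩
  obtain ⟨c, hc, hFc⟩ : ∃ c : ℂ, (c = 0 ∨ c = 1) ∧
      F = X 0 ^ 2 * X 1 - C c * (X 0 * X 1 ^ 2) := by
    rcases hF with rfl | rfl
    · exact ⟨1, Or.inr rfl, by simp⟩
    · exact ⟨0, Or.inl rfl, by simp⟩
  have hF3 : F.IsHomogeneous 3 := hFc ▸ isHomogeneous_cubic c
  have hF0 : F ≠ 0 := hFc ▸ cubic_ne_zero hc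
  have hFw : IsWeightedHomogeneous (tailWeight k) F 0 := hFc ▸ isWeightedHomogeneous_cubic c
  rw [span_mul_eq_span_basisElement hFc hF3 hK (by omega) (by omega),
    finrank_span_eq_card (linearIndependent_basisElement hF0 hFw _), Fintype.card_coe,
    show s + (d - s) = d by omega, card_basisExponents hd]
end
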